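/- If the complement ℕ \ range(a) is infinite, then for every y ∈ 2^ω the fiber f⁻¹({y}) of the h-shuffle f is uncountable. -/

import Mathlib

/-- The length-`n` prefix of a real `x : ℕ → Bool`, as a finite binary string. -/
def pre (x : ℕ → Bool) (n : ℕ) : List Bool := (List.range n).map x

/-- The `h`-shuffle determined by the enumeration `a` and the hash `h`:
`f(x)(i) = x(a i) XOR h(x↾(a i))`. -/
def shuffle (a : ℕ → ℕ) (h : List Bool → Bool) (x : ℕ → Bool) : ℕ → Bool :=
  fun i => xor (x (a i)) (h (pre x (a i)))

theorem exists_eq_apply_pre (φ : ℕ → List Bool → Bool) :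
    ∃ x : ℕ → Bool, ∀ n, x n = φ n (pre x n) := by
  let p : ℕ → List Bool := fun n => Nat.rec [] (fun k s => s ++ [φ k s]) n
  refine ⟨fun n => φ n (p n), fun n => ?_⟩
  have hp : ∀ n, pre (fun n => φ n (p n)) n = p n := by
    intro n
    induction n with
    | zero => rfl
    | succ k ih =>
      have : pre (fun n => φ n (p n)) (k + 1) = pre (fun n => φ n (p n)) k ++ [φ k (p k)] := by
        simp [pre, List.range_succ]
      rw [this, ih]
  rw [hp]

/-- Every fiber of a shuffle contains a real with arbitrarily prescribed values off `range a`. -/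
theorem exists_mem_shuffle_fiber (a : ℕ → ℕ) (ha : Function.Injective a)
    (h : List Bool → Bool) (y z : ℕ → Bool) :
    ∃ x ∈ shuffle a h ⁻¹' {y}, ∀ n ∉ Set.range a, x n = z n := by
  classical
  obtain ⟨x, hx⟩ := exists_eq_apply_pre fun n s =>
    if n ∈ Set.range a then xor (y (Function.invFun a n)) (h s) else z n
  refine ⟨x, ?_, fun n hn => by rw [hx, if_neg hn]⟩
  rw [Set.mem_preimage, Set.mem_singleton_iff]
  funext i
  rw [shuffle, hx, if_pos (Set.mem_range_self i), Function.leftInverse_invFun ha i]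
  simp

/-- If `ℕ \ range a` is infinite, every fiber of the `h`-shuffle is uncountable. -/
theorem shuffle_fiber_uncountable (a : ℕ → ℕ) (ha : Function.Injective a)
    (h : List Bool → Bool) (hinf : (Set.range a)ᶜ.Infinite) :
    ∀ y : ℕ → Bool, ¬ (shuffle a h ⁻¹' {y}).Countable := by
  classical
  intro y hc
  have e := hinf.natEmbedding
  obtain ⟨x₀, hx₀, -⟩ := exists_mem_shuffle_fiber a ha h y fun _ => false
  obtain ⟨g, hg⟩ := hc.exists_eq_range ⟨x₀, hx₀⟩
  refine Function.cantor_surjective (fun n => {k | g n (e k) = true} : ℕ → Set ℕ) fun W => ?_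
  obtain ⟨x, hx, hxz⟩ := exists_mem_shuffle_fiber a ha h y
    fun n => decide (∃ k ∈ W, (e k : ℕ) = n)
  rw [hg] at hx
  obtain ⟨n, rfl⟩ := hx
  refine ⟨n, Set.ext fun k => ?_⟩
  have hk := hxz (e k) (e k).2
  simp [hk, Subtype.val_inj, e.injective.eq_iff]
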